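/- Let 0 < α < 1 and y₀ ∈ ℝ, and define y(t) = y₀ Σ_{n=0}^∞ t^{nα}/Γ(nα+1) for t ≥ 0 (that is, y(t) = y₀ E_α(t^α)). Then y(0) = y₀, y is differentiable on (0,∞), and for every t > 0 one has (1/Γ(1-α)) ∫_0^t y'(s) (t-s)^{-α} ds = y(t). (That is, y solves the Caputo relaxation equation ᶜD^α y(t) = y(t) with y(0) = y₀.) -/

import Mathlib

open MeasureTheory Set

theorem Real.rpow_mul_exp_neg_le_Gamma_add_one {x R : ℝ} (hx : 0 ≤ x) (hR : 0 < R) :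
    R ^ x * Real.exp (-R) ≤ Real.Gamma (x + 1) := by
  have hint : IntegrableOn (fun t : ℝ => Real.exp (-t) * t ^ (x + 1 - 1)) (Ioi 0) :=
    Real.GammaIntegral_convergent (by linarith)
  rw [Real.Gamma_eq_integral (by linarith), ← integral_exp_neg_Ioi, ← integral_const_mul]
  calc ∫ t in Ioi R, R ^ x * Real.exp (-t)
      ≤ ∫ t in Ioi R, Real.exp (-t) * t ^ (x + 1 - 1) := by
        refine setIntegral_mono_on ((integrableOn_exp_neg_Ioi R).const_mul _)
          (hint.mono_set (Ioi_subset_Ioi hR.le)) measurableSet_Ioi fun t ht => ?_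
        rw [add_sub_cancel_right, mul_comm]
        gcongr
        exact le_of_lt ht
    _ ≤ _ := by
        refine setIntegral_mono_set hint ?_ (Ioi_subset_Ioi hR.le).eventuallyLE
        filter_upwards [ae_restrict_mem measurableSet_Ioi] with t ht
        have : (0 : ℝ) < t := ht
        positivity

theorem Real.integral_rpow_mul_sub_rpow {u v t : ℝ} (hu : 0 < u) (hv : 0 < v) (ht : 0 < t) :
    ∫ s in (0 : ℝ)..t, s ^ (u - 1) * (t - s) ^ (v - 1) =
      t ^ (u + v - 1) * (Real.Gamma u * Real.Gamma v / Real.Gamma (u + v)) := by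
  have h := Complex.betaIntegral_scaled u v ht
  rw [Complex.betaIntegral_eq_Gamma_mul_div _ _ (by simpa) (by simpa)] at h
  apply Complex.ofReal_injective
  rw [← intervalIntegral.integral_ofReal]
  convert h using 1
  · refine intervalIntegral.integral_congr fun s hs => ?_
    rw [uIcc_of_le ht.le] at hs
    simp only [Complex.ofReal_mul]
    rw [Complex.ofReal_cpow hs.1, Complex.ofReal_cpow (sub_nonneg.2 hs.2)]
    push_cast
    rfl
  · rw [Complex.ofReal_mul, Complex.ofReal_cpow ht.le]
    push_cast [← Complex.Gamma_ofReal]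
    rfl

theorem summable_natCast_mul_rpow_div_Gamma {α T : ℝ} (hα : 0 < α) (hT : 0 < T) (k : ℕ) :
    Summable fun n : ℕ => (n : ℝ) ^ k * (T ^ ((n : ℝ) * α) / Real.Gamma ((n : ℝ) * α + 1)) := by
  have hq : ‖(2⁻¹ : ℝ) ^ α‖ < 1 := by
    rw [Real.norm_of_nonneg (by positivity)]
    exact Real.rpow_lt_one (by norm_num) (by norm_num) hα
  refine Summable.of_nonneg_of_le (fun n => ?_) (fun n => ?_)
    ((summable_pow_mul_geometric_of_norm_lt_one k hq).mul_left (Real.exp (2 * T)))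
  · have := Real.Gamma_pos_of_pos (show 0 < (n : ℝ) * α + 1 by positivity)
    positivity
  · have hΓ := Real.rpow_mul_exp_neg_le_Gamma_add_one (x := (n : ℝ) * α) (R := 2 * T)
      (by positivity) (by positivity)
    have hpos := Real.Gamma_pos_of_pos (show 0 < (n : ℝ) * α + 1 by positivity)
    rw [mul_left_comm]
    gcongr
    rw [div_le_iff₀ hpos]
    calc T ^ ((n : ℝ) * α)
        = Real.exp (2 * T) * ((2⁻¹ : ℝ) ^ α) ^ n *
            ((2 * T) ^ ((n : ℝ) * α) * Real.exp (-(2 * T))) := by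
          rw [← Real.rpow_mul_natCast (by norm_num), mul_comm α, Real.mul_rpow (by norm_num) hT.le,
            Real.inv_rpow (by norm_num), Real.exp_neg]
          have : (0 : ℝ) < 2 ^ ((n : ℝ) * α) := by positivity
          field_simp
      _ ≤ _ := by gcongr

theorem hasDerivAt_tsum_rpow_div_Gamma {α s : ℝ} (hα : 0 < α) (hs : 0 < s) :
    HasDerivAt (fun t : ℝ => ∑' n : ℕ, t ^ ((n : ℝ) * α) / Real.Gamma ((n : ℝ) * α + 1))
      (∑' n : ℕ, (n : ℝ) * α * s ^ ((n : ℝ) * α - 1) / Real.Gamma ((n : ℝ) * α + 1)) s := by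
  have hmem : s ∈ Ioo (s / 2) (2 * s) := ⟨by linarith, by linarith⟩
  have hsum := ((summable_natCast_mul_rpow_div_Gamma hα (show 0 < 2 * s by positivity) 1).mul_left
    (α / (s / 2)))
  refine hasDerivAt_tsum_of_isPreconnected hsum isOpen_Ioo isPreconnected_Ioo
    (g := fun (n : ℕ) (t : ℝ) => t ^ ((n : ℝ) * α) / Real.Gamma ((n : ℝ) * α + 1))
    (g' := fun (n : ℕ) (t : ℝ) =>
      (n : ℝ) * α * t ^ ((n : ℝ) * α - 1) / Real.Gamma ((n : ℝ) * α + 1))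
    (fun n t ht => ?_) (fun n t ht => ?_) hmem ?_ hmem
  · have ht0 : t ≠ 0 := by linarith [ht.1]
    exact (Real.hasDerivAt_rpow_const (Or.inl ht0)).div_const _
  · have ht0 : 0 < t := by linarith [ht.1]
    have hpos := Real.Gamma_pos_of_pos (show 0 < (n : ℝ) * α + 1 by positivity)
    rw [Real.norm_of_nonneg (by positivity), Real.rpow_sub_one ht0.ne', pow_one]
    calc (n : ℝ) * α * (t ^ ((n : ℝ) * α) / t) / Real.Gamma ((n : ℝ) * α + 1)
        = α / t * (n * (t ^ ((n : ℝ) * α) / Real.Gamma ((n : ℝ) * α + 1))) := by ring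
      _ ≤ _ := by
        gcongr
        · exact ht.1.le
        · exact ht.2.le
  · simpa using summable_natCast_mul_rpow_div_Gamma hα hs 0

theorem integral_deriv_rpow_div_Gamma_mul_sub_rpow {α t : ℝ} (hα₁ : 0 < α) (hα₂ : α < 1)
    (ht : 0 < t) (n : ℕ) :
    ∫ s in (0 : ℝ)..t, ((n + 1 : ℕ) : ℝ) * α * s ^ (((n + 1 : ℕ) : ℝ) * α - 1) /
        Real.Gamma (((n + 1 : ℕ) : ℝ) * α + 1) * (t - s) ^ (-α) =
      Real.Gamma (1 - α) * (t ^ ((n : ℝ) * α) / Real.Gamma ((n : ℝ) * α + 1)) := by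
  have hu : 0 < ((n + 1 : ℕ) : ℝ) * α := by positivity
  have h := Real.integral_rpow_mul_sub_rpow hu (sub_pos.2 hα₂) ht
  have hΓ := Real.Gamma_pos_of_pos hu
  calc _ = ((n + 1 : ℕ) : ℝ) * α / Real.Gamma (((n + 1 : ℕ) : ℝ) * α + 1) *
        ∫ s in (0 : ℝ)..t, s ^ (((n + 1 : ℕ) : ℝ) * α - 1) * (t - s) ^ (1 - α - 1) := by
        rw [← intervalIntegral.integral_const_mul]
        refine intervalIntegral.integral_congr fun s _ => ?_
        rw [show 1 - α - 1 = -α by ring]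
        ring
    _ = _ := by
        rw [h, Real.Gamma_add_one hu.ne',
          show ((n + 1 : ℕ) : ℝ) * α + (1 - α) = (n : ℝ) * α + 1 by push_cast; ring,
          add_sub_cancel_right]
        field_simp

theorem integral_tsum_deriv_rpow_div_Gamma_mul_sub_rpow {α t : ℝ} (hα₁ : 0 < α) (hα₂ : α < 1)
    (ht : 0 < t) :
    ∫ s in (0 : ℝ)..t, (∑' n : ℕ, (n : ℝ) * α * s ^ ((n : ℝ) * α - 1) /
        Real.Gamma ((n : ℝ) * α + 1)) * (t - s) ^ (-α) =
      Real.Gamma (1 - α) * ∑' n : ℕ, t ^ ((n : ℝ) * α) / Real.Gamma ((n : ℝ) * α + 1) := by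
  set F : ℕ → ℝ → ℝ := fun n s => (n : ℝ) * α * s ^ ((n : ℝ) * α - 1) /
        Real.Gamma ((n : ℝ) * α + 1) * (t - s) ^ (-α) with hF
  have hval : ∀ n : ℕ, ∫ s in Ioc 0 t, F (n + 1) s =
      Real.Gamma (1 - α) * (t ^ ((n : ℝ) * α) / Real.Gamma ((n : ℝ) * α + 1)) := fun n => by
    rw [← intervalIntegral.integral_of_le ht.le]
    exact integral_deriv_rpow_div_Gamma_mul_sub_rpow hα₁ hα₂ ht n
  have hΓ₁ := Real.Gamma_pos_of_pos (sub_pos.2 hα₂)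
  have hΓ : ∀ n : ℕ, 0 < Real.Gamma ((n : ℝ) * α + 1) := fun n =>
    Real.Gamma_pos_of_pos (by positivity)
  have hzero : F 0 = 0 := by ext s; simp [hF]
  have hint : ∀ n, Integrable (F n) (volume.restrict (Ioc 0 t)) := by
    rintro (_ | n)
    · rw [hzero]; exact integrable_zero _ _ _
    · refine not_imp_comm.1 integral_undef ?_
      rw [hval]
      have := hΓ n
      positivity
  have hnorm : ∀ n, ∫ s in Ioc 0 t, ‖F n s‖ = ∫ s in Ioc 0 t, F n s := fun n =>
    setIntegral_congr_fun measurableSet_Ioc fun s hs => by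
      have h₁ := hs.1
      have h₂ := sub_nonneg.2 hs.2
      have := hΓ n
      exact Real.norm_of_nonneg (by positivity)
  have hsum : Summable fun n => ∫ s in Ioc 0 t, F n s := by
    rw [← summable_nat_add_iff 1]
    simp_rw [hval]
    simpa using (summable_natCast_mul_rpow_div_Gamma hα₁ ht 0).mul_left (Real.Gamma (1 - α))
  have key := integral_tsum_of_summable_integral_norm hint (by simpa only [hnorm] using hsum)
  rw [hsum.tsum_eq_zero_add, hzero] at key
  simp_rw [hval, tsum_mul_left] at key
  rw [intervalIntegral.integral_of_le ht.le]
  simp_rw [← tsum_mul_right]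
  simpa using key.symm

/-- For `0 < α < 1`, the function `y(t) = y₀ E_α(t^α)`,
i.e. `y(t) = y₀ Σ_{n=0}^∞ t^(nα)/Γ(nα+1)`, satisfies `y(0) = y₀`, is differentiable
on `(0,∞)`, and for every `t > 0`,
`(1/Γ(1-α)) ∫_0^t y'(s)(t-s)^(-α) ds = y(t)`; that is, `y` solves the Caputo
relaxation equation `ᶜD^α y = y` with `y(0) = y₀`. -/
theorem mittagLeffler_solves_caputo_relaxation (α y₀ : ℝ) (hα₁ : 0 < α) (hα₂ : α < 1)
    (y : ℝ → ℝ)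
    (hy : ∀ t : ℝ, y t = y₀ * ∑' n : ℕ, t ^ ((n : ℝ) * α) / Real.Gamma ((n : ℝ) * α + 1)) :
    y 0 = y₀ ∧
    DifferentiableOn ℝ y (Set.Ioi 0) ∧
    ∀ t > (0:ℝ),
      (1 / Real.Gamma (1 - α)) * ∫ s in (0:ℝ)..t, deriv y s * (t - s) ^ (-α) = y t := by
  have hderiv : ∀ s : ℝ, 0 < s → HasDerivAt y (y₀ * ∑' n : ℕ, (n : ℝ) * α *
      s ^ ((n : ℝ) * α - 1) / Real.Gamma ((n : ℝ) * α + 1)) s := fun s hs => by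
    rw [funext hy]
    exact (hasDerivAt_tsum_rpow_div_Gamma hα₁ hs).const_mul y₀
  refine ⟨?_, fun s hs => (hderiv s hs).differentiableAt.differentiableWithinAt, fun t ht => ?_⟩
  · rw [hy, tsum_eq_single 0 fun n hn => ?_]
    · simp
    · rw [Real.zero_rpow (by positivity), zero_div]
  · have hΓ := Real.Gamma_pos_of_pos (sub_pos.2 hα₂)
    rw [intervalIntegral.integral_congr_ae (g := fun s => y₀ * ((∑' n : ℕ, (n : ℝ) * α *
        s ^ ((n : ℝ) * α - 1) / Real.Gamma ((n : ℝ) * α + 1)) * (t - s) ^ (-α))),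
      intervalIntegral.integral_const_mul,
      integral_tsum_deriv_rpow_div_Gamma_mul_sub_rpow hα₁ hα₂ ht, hy]
    · field_simp
    · refine Filter.Eventually.of_forall fun s hs => ?_
      rw [uIoc_of_le ht.le] at hs
      rw [(hderiv s hs.1).deriv, mul_assoc]
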